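/- For a positive integer N and a nonnegative integer a, define F_N(λ;a) := ∫_{ℝ^N} ∏_{j=1}^N e^{−x_j²}(λ − x_j)^a ∏_{1≤j<k≤N}(x_k − x_j)² dx₁⋯dx_N for λ ∈ ℝ, and on any open interval J ⊆ ℝ where F_N(·;a) is nonvanishing define V_N(λ;a) := (d/dλ) log F_N(λ;a) = F_N'(λ;a)/F_N(λ;a). Then V_N(·;a) satisfies the Jimbo–Miwa–Okamoto σ-form of the Painlevé IV equation (V_N''(λ))² − 4(λ·V_N'(λ) − V_N(λ))² + 4V_N'(λ)(V_N'(λ) − 2a)(V_N'(λ) + 2N) = 0 for all λ ∈ J. -/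

import Mathlib

open MeasureTheory
open Polynomial

namespace GUEMoments

section Determinants

open Matrix

variable {R : Type*} [CommRing R]

theorem det_mul_det_adjugate_toBlocks₂₂ {m n : Type*} [Fintype m] [Fintype n] [DecidableEq m]
    [DecidableEq n] (M : Matrix (m ⊕ n) (m ⊕ n) R) :
    M.det * M.adjugate.toBlocks₂₂.det = M.toBlocks₁₁.det * M.det ^ Fintype.card n := by
  set P := M.adjugate
  have hmul : M * fromBlocks 1 P.toBlocks₁₂ 0 P.toBlocks₂₂ =
      fromBlocks M.toBlocks₁₁ 0 M.toBlocks₂₁ (M.det • (1 : Matrix n n R)) := by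
    have h : M * P = M.det • (1 : Matrix (m ⊕ n) (m ⊕ n) R) := mul_adjugate M
    rw [← fromBlocks_toBlocks M, ← fromBlocks_toBlocks P, fromBlocks_multiply,
      ← fromBlocks_one, fromBlocks_smul] at h
    obtain ⟨-, h₁₂, -, h₂₂⟩ := fromBlocks_inj.mp h
    conv_lhs => rw [← fromBlocks_toBlocks M]
    rw [fromBlocks_multiply]
    simp only [Matrix.mul_one, Matrix.mul_zero, add_zero, fromBlocks_toBlocks] at h₁₂ h₂₂ ⊢
    rw [h₁₂, h₂₂, smul_zero]
  have hdet := congrArg det hmul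
  rwa [det_mul, det_fromBlocks_zero₂₁, det_fromBlocks_zero₁₂, det_one, one_mul, det_smul, det_one,
    mul_one] at hdet

theorem det_adjugate_toBlocks₂₂ {m : Type*} [Fintype m] [DecidableEq m]
    (M : Matrix (m ⊕ Fin 2) (m ⊕ Fin 2) R) :
    M.adjugate.toBlocks₂₂.det = M.toBlocks₁₁.det * M.det := by
  have generic : (mvPolynomialX (m ⊕ Fin 2) (m ⊕ Fin 2) ℤ).adjugate.toBlocks₂₂.det =
      (mvPolynomialX (m ⊕ Fin 2) (m ⊕ Fin 2) ℤ).toBlocks₁₁.det *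
        (mvPolynomialX (m ⊕ Fin 2) (m ⊕ Fin 2) ℤ).det := by
    apply mul_left_cancel₀ (det_mvPolynomialX_ne_zero (m ⊕ Fin 2) ℤ)
    rw [det_mul_det_adjugate_toBlocks₂₂, Fintype.card_fin]
    ring
  let φ : MvPolynomial ((m ⊕ Fin 2) × (m ⊕ Fin 2)) ℤ →+* R :=
    MvPolynomial.eval₂Hom (Int.castRingHom R) fun p => M p.1 p.2
  have hφ : φ.mapMatrix (mvPolynomialX (m ⊕ Fin 2) (m ⊕ Fin 2) ℤ) = M := by
    ext i j
    simp [φ]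
  have h := congrArg φ generic
  rw [map_mul, φ.map_det, φ.map_det, φ.map_det] at h
  have h₂₂ : φ.mapMatrix (mvPolynomialX (m ⊕ Fin 2) (m ⊕ Fin 2) ℤ).adjugate.toBlocks₂₂ =
      (φ.mapMatrix (mvPolynomialX (m ⊕ Fin 2) (m ⊕ Fin 2) ℤ).adjugate).toBlocks₂₂ := rfl
  have h₁₁ : φ.mapMatrix (mvPolynomialX (m ⊕ Fin 2) (m ⊕ Fin 2) ℤ).toBlocks₁₁ =
      (φ.mapMatrix (mvPolynomialX (m ⊕ Fin 2) (m ⊕ Fin 2) ℤ)).toBlocks₁₁ := rfl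
  rwa [h₂₂, h₁₁, φ.map_adjugate, hφ] at h

/-- The Desnanot–Jacobi identity, for the last two rows and columns. -/
theorem desnanot_jacobi {m : ℕ} (M : Matrix (Fin (m + 2)) (Fin (m + 2)) R) :
    M.det * (M.submatrix (Fin.castAdd 2) (Fin.castAdd 2)).det =
      (M.submatrix Fin.castSucc Fin.castSucc).det *
          (M.submatrix (Fin.last m).castSucc.succAbove (Fin.last m).castSucc.succAbove).det -
        (M.submatrix Fin.castSucc (Fin.last m).castSucc.succAbove).det *
          (M.submatrix (Fin.last m).castSucc.succAbove Fin.castSucc).det := by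
  have h := det_adjugate_toBlocks₂₂ (M.submatrix (finSumFinEquiv (m := m) (n := 2)) finSumFinEquiv)
  rw [det_submatrix_equiv_self, adjugate_submatrix_equiv_self] at h
  have h₁₁ : (M.submatrix (finSumFinEquiv (m := m) (n := 2)) finSumFinEquiv).toBlocks₁₁ =
      M.submatrix (Fin.castAdd 2) (Fin.castAdd 2) := by
    ext i j; simp [toBlocks₁₁]
  rw [h₁₁, det_fin_two] at h
  have e0 : (finSumFinEquiv (Sum.inr 0 : Fin m ⊕ Fin 2)) = (Fin.last m).castSucc := by
    ext; simp
  have e1 : (finSumFinEquiv (Sum.inr 1 : Fin m ⊕ Fin 2)) = Fin.last (m + 1) := by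
    ext; simp
  simp only [toBlocks₂₂, of_apply, submatrix_apply, e0, e1,
    adjugate_fin_succ_eq_det_submatrix, Fin.succAbove_last, Fin.val_castSucc, Fin.val_last] at h
  have s0 : ((-1 : R)) ^ (m + m) = 1 := (Even.add_self m).neg_one_pow
  have s1 : ((-1 : R)) ^ (m + 1 + (m + 1)) = 1 := (Even.add_self (m + 1)).neg_one_pow
  have s2 : ((-1 : R)) ^ (m + 1 + m) = -1 := by
    rw [show m + 1 + m = m + m + 1 by ring, pow_succ, s0, one_mul]
  have s3 : ((-1 : R)) ^ (m + (m + 1)) = -1 := by rw [← add_assoc, pow_succ, s0, one_mul]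
  rw [s0, s1, s2, s3] at h
  linear_combination -h

theorem derivative_det {n : Type*} [Fintype n] [DecidableEq n] (M : Matrix n n R[X]) :
    derivative M.det = ∑ j, (M.updateCol j fun i => derivative (M i j)).det := by
  simp only [det_apply', derivative_sum]
  rw [Finset.sum_comm]
  refine Finset.sum_congr rfl fun σ _ => ?_
  rw [derivative_mul, derivative_intCast, zero_mul, zero_add, derivative_prod_finset,
    Finset.mul_sum]
  refine Finset.sum_congr rfl fun j _ => ?_
  rw [← Finset.mul_prod_erase _ _ (Finset.mem_univ j), updateCol_self, mul_comm (derivative _)]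
  congr 2
  refine Finset.prod_congr rfl fun k hk => ?_
  rw [updateCol_ne (Finset.ne_of_mem_erase hk)]

/-- The determinant with entries `q (rᵢ + cⱼ)`, a minor of the Hankel matrix of `q`. -/
noncomputable def hankelMinor (q : ℕ → R[X]) {n : ℕ} (r c : Fin n → ℕ) : R[X] :=
  (Matrix.of fun i j => q (r i + c j)).det

theorem hankelMinor_comm (q : ℕ → R[X]) {n : ℕ} (r c : Fin n → ℕ) :
    hankelMinor q r c = hankelMinor q c r := by
  rw [hankelMinor, ← det_transpose]
  congr 1
  ext i j : 2
  simp [add_comm]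

/-- The Hankel determinant of order `n` of the sequence `q`. -/
noncomputable def hankelDet (q : ℕ → R[X]) (n : ℕ) : R[X] :=
  hankelMinor q (n := n) Fin.val Fin.val

/-- The exponents `0, …, m - 1, m + 1`. -/
def gapIndex (m : ℕ) (j : Fin (m + 1)) : ℕ := (Fin.last m).castSucc.succAbove j

theorem gapIndex_last (m : ℕ) : gapIndex m (Fin.last m) = m + 1 := by
  simp [gapIndex]

theorem gapIndex_castSucc (m : ℕ) (j : Fin m) : gapIndex m j.castSucc = j := by
  rw [gapIndex, Fin.succAbove_of_castSucc_lt _ _ (by simp [Fin.lt_def])]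
  simp

theorem derivative_hankelMinor {q : ℕ → R[X]}
    (hq : ∀ k, derivative (q k) = 2 * q (k + 1) - 2 * X * q k) {m : ℕ} (r : Fin (m + 1) → ℕ) :
    derivative (hankelMinor q r Fin.val) =
      2 * hankelMinor q r (gapIndex m) - 2 * ((m : R[X]) + 1) * X * hankelMinor q r Fin.val := by
  set M : Matrix (Fin (m + 1)) (Fin (m + 1)) R[X] := Matrix.of fun i j => q (r i + j) with hM
  have hcol (j : Fin (m + 1)) : (M.updateCol j fun i => derivative (M i j)).det =
      2 * (M.updateCol j fun i => q (r i + j + 1)).det - 2 * X * M.det := by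
    have : (fun i => derivative (M i j)) =
        (2 : R[X]) • (fun i => q (r i + j + 1)) + (-(2 * X) : R[X]) • fun i => M i j := by
      ext1 i
      simp [hM, hq]
      ring
    rw [this, det_updateCol_add, det_updateCol_smul, det_updateCol_smul, updateCol_eq_self]
    ring
  have hzero (j : Fin m) : (M.updateCol j.castSucc fun i => q (r i + j.castSucc + 1)).det = 0 := by
    apply det_zero_of_column_eq (Fin.castSucc_lt_succ (i := j)).ne
    intro i
    rw [updateCol_self, updateCol_ne (Fin.castSucc_lt_succ (i := j)).ne']
    simp [hM, add_assoc]
  have hlast : (M.updateCol (Fin.last m) fun i => q (r i + Fin.last m + 1)).det =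
      hankelMinor q r (gapIndex m) := by
    rw [hankelMinor]
    congr 1
    ext i j : 2
    refine Fin.lastCases ?_ (fun j => ?_) j
    · simp [gapIndex_last, add_assoc]
    · rw [updateCol_ne (Fin.castSucc_lt_last j).ne]
      simp [gapIndex_castSucc, hM]
  have hdet : hankelMinor q r Fin.val = M.det := rfl
  rw [hdet, derivative_det]
  simp_rw [hcol]
  rw [Finset.sum_sub_distrib, ← Finset.mul_sum, Fin.sum_univ_castSucc]
  simp only [hzero, hlast]
  simp
  ring

/-- The Toda equation for Hankel determinants. -/
theorem hankelDet_toda {q : ℕ → R[X]}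
    (hq : ∀ k, derivative (q k) = 2 * q (k + 1) - 2 * X * q k) (m : ℕ) :
    4 * hankelDet q (m + 2) * hankelDet q m =
      hankelDet q (m + 1) * derivative (derivative (hankelDet q (m + 1))) -
        derivative (hankelDet q (m + 1)) ^ 2 + 2 * ((m : R[X]) + 1) * hankelDet q (m + 1) ^ 2 := by
  have hJ : hankelDet q (m + 2) * hankelDet q m =
      hankelDet q (m + 1) * hankelMinor q (gapIndex m) (gapIndex m) -
        hankelMinor q Fin.val (gapIndex m) * hankelMinor q (gapIndex m) Fin.val :=
    desnanot_jacobi (Matrix.of fun i j : Fin (m + 2) => q (i + j))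
  have h₁ := derivative_hankelMinor hq (m := m) Fin.val
  have h₂ := derivative_hankelMinor hq (gapIndex m)
  rw [hankelMinor_comm q (gapIndex m) Fin.val] at h₂ hJ
  rw [← hankelDet] at h₁
  rw [h₁]
  simp only [derivative_sub, derivative_mul, derivative_add, derivative_ofNat, derivative_natCast,
    derivative_one, derivative_X, h₁, h₂]
  linear_combination 4 * hJ

end Determinants

section Moments

theorem hankelDet_ne_zero {q : ℕ → ℝ[X]}
    (hq : ∀ k, derivative (q k) = 2 * q (k + 1) - 2 * X * q k) (h0 : q 0 ≠ 0) (n : ℕ) :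
    hankelDet q n ≠ 0 := by
  induction n using Nat.twoStepInduction with
  | zero => simp [hankelDet, hankelMinor]
  | one => simpa [hankelDet, hankelMinor] using h0
  | more m _ ih =>
    intro hzero
    have htoda := hankelDet_toda hq m
    rw [hzero] at htoda
    set T := hankelDet q (m + 1)
    have hT : 2 * ((m : ℝ[X]) + 1) * T ^ 2 = derivative T ^ 2 - T * derivative (derivative T) := by
      linear_combination -htoda
    have hdeg : (2 * ((m : ℝ[X]) + 1) * T ^ 2).degree = T.degree + T.degree := by
      have : (2 * ((m : ℝ[X]) + 1)) = C (2 * ((m : ℝ) + 1)) := by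
        rw [C_mul, C_ofNat, C_add, C_1, C_eq_natCast]
      rw [this, degree_C_mul (by positivity), sq, degree_mul]
    have hbot : T.degree ≠ ⊥ := degree_ne_bot.mpr ih
    have hlt : (derivative T).degree < T.degree := degree_derivative_lt ih
    have hlt₂ : (derivative (derivative T)).degree < T.degree := degree_derivative_le.trans_lt hlt
    refine lt_irrefl (T.degree + T.degree) ?_
    calc T.degree + T.degree = (derivative T ^ 2 - T * derivative (derivative T)).degree := by
          rw [← hT, hdeg]
      _ ≤ max (derivative T ^ 2).degree (T * derivative (derivative T)).degree := degree_sub_le _ _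
      _ < T.degree + T.degree := by
        rw [sq, degree_mul, degree_mul]
        have hmono := WithBot.add_lt_add_left hbot hlt
        exact max_lt ((add_le_add_left hlt.le _).trans_lt hmono)
          (WithBot.add_lt_add_left hbot hlt₂)

/-- The polynomial `∫ (X - x) ^ n exp (-x ^ 2) dx`. -/
noncomputable def momentPoly : ℕ → ℝ[X]
  | 0 => C √Real.pi
  | n + 1 => X * momentPoly n + C (1 / 2) * derivative (momentPoly n)

theorem derivative_momentPoly (n : ℕ) :
    derivative (momentPoly n) = 2 * momentPoly (n + 1) - 2 * X * momentPoly n := by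
  have h : (2 : ℝ[X]) * C (1 / 2) = 1 := by
    rw [← C_ofNat, ← C_mul]; norm_num
  rw [momentPoly]
  linear_combination (-derivative (momentPoly n)) * h

theorem derivative_momentPoly_succ (n : ℕ) :
    derivative (momentPoly (n + 1)) = ((n : ℝ[X]) + 1) * momentPoly n := by
  induction n with
  | zero => simp [momentPoly]
  | succ n ih =>
    rw [momentPoly]
    simp only [derivative_add, derivative_mul, derivative_X, derivative_C, ih, derivative_natCast,
      derivative_one]
    rw [momentPoly]
    push_cast
    ring

theorem derivative_derivative_momentPoly (n : ℕ) :
    derivative (derivative (momentPoly n)) =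
      2 * (n : ℝ[X]) * momentPoly n - 2 * X * derivative (momentPoly n) := by
  nth_rw 1 [derivative_momentPoly]
  simp only [derivative_sub, derivative_mul, derivative_momentPoly_succ, derivative_ofNat,
    derivative_X]
  ring

theorem momentPoly_ne_zero (n : ℕ) : momentPoly n ≠ 0 := by
  induction n with
  | zero => simp [momentPoly, Real.pi_pos.le, Real.sqrt_eq_zero, Real.pi_ne_zero]
  | succ n ih =>
    intro h
    have h' := derivative_momentPoly_succ n
    rw [h, derivative_zero] at h'
    exact mul_ne_zero (by exact_mod_cast n.succ_ne_zero) ih h'.symm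

theorem integrable_eval_mul_exp_neg_sq (p : ℝ[X]) :
    Integrable fun x : ℝ => p.eval x * Real.exp (-x ^ 2) := by
  induction p using Polynomial.induction_on' with
  | add p q hp hq =>
    simp only [eval_add, add_mul]
    exact hp.add hq
  | monomial n c =>
    have h := (integrable_rpow_mul_exp_neg_mul_sq (b := 1) one_pos (s := n)
      (by linarith [n.cast_nonneg (α := ℝ)])).const_mul c
    simpa [mul_assoc] using h

theorem integrable_sub_pow_mul_exp_neg_sq (lam : ℝ) (n : ℕ) :
    Integrable fun x : ℝ => (lam - x) ^ n * Real.exp (-x ^ 2) := by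
  have h := integrable_eval_mul_exp_neg_sq ((C lam - X) ^ n)
  simpa only [eval_pow, eval_sub, eval_C, eval_X] using h

theorem integral_sub_pow_succ_mul_exp_neg_sq (lam : ℝ) (n : ℕ) :
    ∫ x : ℝ, (lam - x) ^ (n + 1) * Real.exp (-x ^ 2) =
      lam * (∫ x : ℝ, (lam - x) ^ n * Real.exp (-x ^ 2)) +
        1 / 2 * (n * ∫ x : ℝ, (lam - x) ^ (n - 1) * Real.exp (-x ^ 2)) := by
  have hderiv (x : ℝ) : HasDerivAt (fun x : ℝ => (lam - x) ^ n * Real.exp (-x ^ 2))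
      (2 * ((lam - x) ^ (n + 1) * Real.exp (-x ^ 2)) -
        (2 * lam) * ((lam - x) ^ n * Real.exp (-x ^ 2)) -
          n * ((lam - x) ^ (n - 1) * Real.exp (-x ^ 2))) x := by
    have h₁ := ((hasDerivAt_id x).const_sub lam).pow n
    have h₂ := ((hasDerivAt_id x).pow 2).neg.exp
    refine (h₁.mul h₂).congr_deriv ?_
    simp
    ring
  have i₁ := (integrable_sub_pow_mul_exp_neg_sq lam (n + 1)).const_mul 2
  have i₂ := (integrable_sub_pow_mul_exp_neg_sq lam n).const_mul (2 * lam)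
  have i₃ := (integrable_sub_pow_mul_exp_neg_sq lam (n - 1)).const_mul (n : ℝ)
  have h := integral_eq_zero_of_hasDerivAt_of_integrable hderiv ((i₁.sub i₂).sub i₃)
    (integrable_sub_pow_mul_exp_neg_sq lam n)
  rw [integral_sub (by exact i₁.sub i₂) i₃, integral_sub i₁ i₂, integral_const_mul, integral_const_mul,
    integral_const_mul] at h
  linear_combination h / 2

theorem eval_momentPoly (lam : ℝ) (n : ℕ) :
    (momentPoly n).eval lam = ∫ x : ℝ, (lam - x) ^ n * Real.exp (-x ^ 2) := by
  induction n using Nat.twoStepInduction with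
  | zero => simpa [momentPoly] using (integral_gaussian 1).symm
  | one =>
    rw [integral_sub_pow_succ_mul_exp_neg_sq]
    have h := integral_gaussian 1
    simp only [neg_one_mul, div_one] at h
    simp [momentPoly, h]
    ring
  | more n ih₀ ih₁ =>
    rw [integral_sub_pow_succ_mul_exp_neg_sq, momentPoly, derivative_momentPoly_succ,
      Nat.add_sub_cancel, ← ih₀, ← ih₁]
    simp

theorem sum_perm_sum_perm_sign_mul_prod {n : ℕ} (g : Fin n → Fin n → ℝ) :
    ∑ σ : Equiv.Perm (Fin n), ∑ τ : Equiv.Perm (Fin n),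
        ((Equiv.Perm.sign σ : ℤ) : ℝ) * ((Equiv.Perm.sign τ : ℤ) : ℝ) * ∏ i, g (σ i) (τ i) =
      n.factorial * (Matrix.of g).det := by
  have h (τ : Equiv.Perm (Fin n)) : ∑ σ : Equiv.Perm (Fin n),
      ((Equiv.Perm.sign σ : ℤ) : ℝ) * ((Equiv.Perm.sign τ : ℤ) : ℝ) * ∏ i, g (σ i) (τ i) =
        (Matrix.of g).det := by
    have hτ := Matrix.det_permute' τ (Matrix.of g)
    have hsq : ((Equiv.Perm.sign τ : ℤ) : ℝ) * ((Equiv.Perm.sign τ : ℤ) : ℝ) = 1 := by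
      rw [← Int.cast_mul, ← Units.val_mul, Int.units_mul_self, Units.val_one, Int.cast_one]
    rw [Matrix.det_apply'] at hτ
    simp only [Matrix.submatrix_apply, Matrix.of_apply, id] at hτ
    rw [← one_mul (Matrix.det _), ← hsq, mul_assoc, ← hτ, Finset.mul_sum]
    exact Finset.sum_congr rfl fun σ _ => by ring
  rw [Finset.sum_comm]
  simp_rw [h]
  simp [Fintype.card_perm]

/-- The multiple integral as a Hankel determinant. -/
theorem integral_eq_factorial_mul_hankelDet (N a : ℕ) (lam : ℝ) :
    ∫ x : Fin N → ℝ, (∏ j, Real.exp (-(x j) ^ 2) * (lam - x j) ^ a)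
        * ∏ j, ∏ k ∈ Finset.Ioi j, (x k - x j) ^ 2 =
      N.factorial * (hankelDet (fun k => momentPoly (a + k)) N).eval lam := by
  let f (σ τ : Equiv.Perm (Fin N)) (i : Fin N) (y : ℝ) : ℝ :=
    (lam - y) ^ (a + ((σ i : ℕ) + (τ i : ℕ))) * Real.exp (-y ^ 2)
  have hint (σ τ : Equiv.Perm (Fin N)) : Integrable fun x : Fin N → ℝ =>
      ((Equiv.Perm.sign σ : ℤ) : ℝ) * ((Equiv.Perm.sign τ : ℤ) : ℝ) * ∏ i, f σ τ i (x i) :=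
    (Integrable.fintype_prod fun i => integrable_sub_pow_mul_exp_neg_sq lam _).const_mul _
  have hexpand (x : Fin N → ℝ) : (∏ j, Real.exp (-(x j) ^ 2) * (lam - x j) ^ a)
        * ∏ j, ∏ k ∈ Finset.Ioi j, (x k - x j) ^ 2 =
      ∑ σ : Equiv.Perm (Fin N), ∑ τ : Equiv.Perm (Fin N),
        ((Equiv.Perm.sign σ : ℤ) : ℝ) * ((Equiv.Perm.sign τ : ℤ) : ℝ) * ∏ i, f σ τ i (x i) := by
    have hV : ∏ j, ∏ k ∈ Finset.Ioi j, (x k - x j) ^ 2 =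
        (Matrix.vandermonde fun i => lam - x i).transpose.det *
          (Matrix.vandermonde fun i => lam - x i).transpose.det := by
      rw [Matrix.det_transpose, Matrix.det_vandermonde, ← sq]
      simp_rw [← Finset.prod_pow]
      exact Finset.prod_congr rfl fun j _ => Finset.prod_congr rfl fun k _ => by ring
    rw [hV, Matrix.det_apply', Finset.sum_mul_sum, Finset.mul_sum]
    refine Finset.sum_congr rfl fun σ _ => ?_
    rw [Finset.mul_sum]
    refine Finset.sum_congr rfl fun τ _ => ?_
    have hprod : ∏ i, f σ τ i (x i) = (∏ j, Real.exp (-(x j) ^ 2) * (lam - x j) ^ a) *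
        ((∏ i, (lam - x i) ^ (σ i : ℕ)) * ∏ i, (lam - x i) ^ (τ i : ℕ)) := by
      rw [← Finset.prod_mul_distrib, ← Finset.prod_mul_distrib]
      exact Finset.prod_congr rfl fun i _ => by simp only [f, pow_add]; ring
    rw [hprod]
    simp only [Matrix.transpose_apply, Matrix.vandermonde_apply]
    ring
  simp_rw [hexpand]
  rw [integral_finsetSum _ fun σ _ => integrable_finsetSum _ fun τ _ => hint σ τ]
  simp_rw [integral_finsetSum _ fun τ _ => hint _ τ, integral_const_mul,
    integral_fintype_prod_volume_eq_prod, f, ← eval_momentPoly]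
  rw [sum_perm_sum_perm_sign_mul_prod fun i j : Fin N => (momentPoly (a + (i + j))).eval lam,
    hankelDet, hankelMinor, ← coe_evalRingHom, RingHom.map_det]
  rfl

end Moments

section PainleveHierarchy

open Filter Topology

theorem eventually_deriv_eq_atTop {f g f' g' : ℝ → ℝ} (hfg : f =ᶠ[atTop] g)
    (hf : ∀ᶠ x in atTop, HasDerivAt f (f' x) x) (hg : ∀ᶠ x in atTop, HasDerivAt g (g' x) x) :
    ∀ᶠ x in atTop, f' x = g' x := by
  obtain ⟨c, hc⟩ := eventually_atTop.mp hfg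
  filter_upwards [hf, hg, eventually_gt_atTop c] with x hfx hgx hx
  refine hfx.unique (hgx.congr_of_eventuallyEq ?_)
  filter_upwards [Ioi_mem_nhds hx] with y hy using hc y (le_of_lt hy)

/-- A sequence of functions `V n` with derivatives `p n` near `+∞` that solves the Toda equation,
together with the Riccati equation that starts the Painlevé IV hierarchy. -/
structure TodaRiccati (a : ℝ) (V p A : ℕ → ℝ → ℝ) : Prop where
  hasDerivAt_V : ∀ n, ∀ᶠ x in atTop, HasDerivAt (V n) (p n x) x
  hasDerivAt_p : ∀ n, ∀ᶠ x in atTop,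
    HasDerivAt (p n) ((p n x + 2 * n) * (V (n + 1) x - V n x) + A n x) x
  A_succ : ∀ n x, A (n + 1) x = (p (n + 1) x + 2 * ((n : ℝ) + 1)) * (V n x - V (n + 1) x)
  ne_zero : ∀ n : ℕ, ∀ᶠ x in atTop, p (n + 1) x + 2 * ((n : ℝ) + 1) ≠ 0
  V_zero : ∀ x, V 0 x = 0
  p_zero : ∀ x, p 0 x = 0
  A_zero : ∀ x, A 0 x = 0
  riccati : ∀ᶠ x in atTop, p 1 x = -V 1 x ^ 2 - 2 * x * V 1 x + 2 * a

theorem TodaRiccati.eventually {a : ℝ} {V p A : ℕ → ℝ → ℝ} (h : TodaRiccati a V p A) (n : ℕ) :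
    (∀ᶠ x in atTop, p (n + 1) x =
        -p n x - (V (n + 1) x - V n x) ^ 2 - 2 * x * (V (n + 1) x - V n x) + 2 * a) ∧
      (∀ᶠ x in atTop, 2 * V n x =
        2 * x * p n x - A n x + (p n x + 2 * n) * (V (n + 1) x - V n x)) ∧
      ∀ᶠ x in atTop, A n x * (V (n + 1) x - V n x) = -p n x * (p n x - 2 * a) := by
  induction n with
  | zero =>
    refine ⟨?_, ?_, ?_⟩
    · filter_upwards [h.riccati] with x hx
      rw [zero_add, hx, h.V_zero, h.p_zero]
      ring
    · exact .of_forall fun x => by simp [h.V_zero, h.p_zero, h.A_zero]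
    · exact .of_forall fun x => by simp [h.p_zero, h.A_zero]
  | succ n ih =>
    obtain ⟨hR, hC, hE⟩ := ih
    have hw (n : ℕ) : ∀ᶠ x in atTop,
        HasDerivAt (fun y => V (n + 1) y - V n y) (p (n + 1) x - p n x) x := by
      filter_upwards [h.hasDerivAt_V n, h.hasDerivAt_V (n + 1)] with x h₀ h₁ using h₁.sub h₀
    have hR' := eventually_deriv_eq_atTop hR (h.hasDerivAt_p (n + 1))
      (g' := fun x => -((p n x + 2 * n) * (V (n + 1) x - V n x) + A n x)
        - 2 * (V (n + 1) x - V n x + x) * (p (n + 1) x - p n x)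
        - 2 * (V (n + 1) x - V n x)) <| by
      filter_upwards [h.hasDerivAt_p n, hw n] with x hp hw
      refine (((hp.neg.sub (hw.pow 2)).sub (((hasDerivAt_id x).const_mul 2).mul hw)).add_const
        (2 * a)).congr_deriv ?_
      simp
      ring
    have hC₁ : ∀ᶠ x in atTop, 2 * V (n + 1) x = 2 * x * p (n + 1) x +
        (p (n + 1) x + 2 * ((n : ℝ) + 1)) *
          ((V (n + 1) x - V n x) + (V (n + 1 + 1) x - V (n + 1) x)) := by
      filter_upwards [hR, hC, hR'] with x hR hC hR'
      rw [h.A_succ] at hR'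
      push_cast at hR'
      linear_combination hC - hR'
    refine ⟨?_, ?_, ?_⟩
    · have hC' := eventually_deriv_eq_atTop hC₁
        (f' := fun x => 2 * p (n + 1) x)
        (g' := fun x => 2 * p (n + 1) x +
          (2 * x + ((V (n + 1) x - V n x) + (V (n + 1 + 1) x - V (n + 1) x))) *
            ((p (n + 1) x + 2 * ((n : ℝ) + 1)) *
              ((V (n + 1 + 1) x - V (n + 1) x) - (V (n + 1) x - V n x))) +
          (p (n + 1) x + 2 * ((n : ℝ) + 1)) * (p (n + 1 + 1) x - p n x))
        (by filter_upwards [h.hasDerivAt_V (n + 1)] with x hx using hx.const_mul 2)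
        (by
          filter_upwards [h.hasDerivAt_p (n + 1), hw n, hw (n + 1)] with x hp hw₀ hw₁
          refine ((((hasDerivAt_id x).const_mul 2).mul hp).add
            ((hp.add_const (2 * ((n : ℝ) + 1))).mul (hw₀.add hw₁))).congr_deriv ?_
          rw [h.A_succ]
          simp
          ring)
      filter_upwards [hR, hC', h.ne_zero n] with x hR hC' hU
      apply mul_left_cancel₀ hU
      linear_combination -hC' + (p (n + 1) x + 2 * ((n : ℝ) + 1)) * hR
    · filter_upwards [hC₁] with x hC₁
      rw [h.A_succ]
      push_cast
      linear_combination hC₁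
    · filter_upwards [hR, hE, hR'] with x hR hE hR'
      rw [h.A_succ] at hR' ⊢
      push_cast at hR'
      linear_combination (V n x - V (n + 1) x) * hR' + hE +
        (p (n + 1) x - p n x) * hR

theorem TodaRiccati.sigma {a : ℝ} {V p A : ℕ → ℝ → ℝ} (h : TodaRiccati a V p A) (n : ℕ) :
    ∀ᶠ x in atTop, ((p n x + 2 * n) * (V (n + 1) x - V n x) + A n x) ^ 2 -
      4 * (x * p n x - V n x) ^ 2 + 4 * p n x * (p n x - 2 * a) * (p n x + 2 * n) = 0 := by
  obtain ⟨-, hC, hE⟩ := h.eventually n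
  filter_upwards [hC, hE] with x hC hE
  have hθ : 2 * (x * p n x - V n x) = A n x - (p n x + 2 * n) * (V (n + 1) x - V n x) := by
    linear_combination -hC
  have hsq := congrArg (· ^ 2) hθ
  linear_combination -hsq + 4 * (p n x + 2 * n) * hE

end PainleveHierarchy

section SigmaForm

open Filter Topology

/-- The logarithmic derivative of a polynomial, as a function. -/
noncomputable def logDerivFun (T : ℝ[X]) (x : ℝ) : ℝ :=
  (derivative T).eval x / T.eval x

/-- The second logarithmic derivative of a polynomial, as a function. -/
noncomputable def logDerivFun₂ (T : ℝ[X]) (x : ℝ) : ℝ :=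
  (T.eval x * (derivative (derivative T)).eval x - (derivative T).eval x ^ 2) / T.eval x ^ 2

/-- The third logarithmic derivative of a polynomial, as a function. -/
noncomputable def logDerivFun₃ (T : ℝ[X]) (x : ℝ) : ℝ :=
  (T.eval x ^ 2 * (derivative (derivative (derivative T))).eval x
    - 3 * T.eval x * (derivative T).eval x * (derivative (derivative T)).eval x
    + 2 * (derivative T).eval x ^ 3) / T.eval x ^ 3

theorem hasDerivAt_logDerivFun {T : ℝ[X]} {x : ℝ} (hx : T.eval x ≠ 0) :
    HasDerivAt (logDerivFun T) (logDerivFun₂ T x) x := by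
  refine (((derivative T).hasDerivAt x).div (T.hasDerivAt x) hx).congr_deriv ?_
  rw [logDerivFun₂]
  ring

theorem hasDerivAt_logDerivFun₂ {T : ℝ[X]} {x : ℝ} (hx : T.eval x ≠ 0) :
    HasDerivAt (logDerivFun₂ T) (logDerivFun₃ T x) x := by
  have h₀ := T.hasDerivAt x
  have h₁ := (derivative T).hasDerivAt x
  have h₂ := (derivative (derivative T)).hasDerivAt x
  refine (((h₀.mul h₂).sub (h₁.pow 2)).div (h₀.pow 2) (pow_ne_zero 2 hx)).congr_deriv ?_
  rw [logDerivFun₃]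
  simp only [Pi.mul_apply, Pi.sub_apply, Pi.pow_apply]
  field_simp
  norm_num
  ring

theorem eventually_eval_ne_zero {T : ℝ[X]} (hT : T ≠ 0) : ∀ᶠ x in atTop, T.eval x ≠ 0 :=
  T.eventually_atTop_not_isRoot hT

/-- The part of the Toda equation for `logDerivFun₃` that involves the previous index. -/
noncomputable def todaTerm (T : ℕ → ℝ[X]) : ℕ → ℝ → ℝ
  | 0, _ => 0
  | n + 1, x => (logDerivFun₂ (T (n + 1)) x + 2 * ((n : ℝ) + 1)) *
      (logDerivFun (T n) x - logDerivFun (T (n + 1)) x)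

theorem logDerivFun₂_add_eq {T : ℕ → ℝ[X]} {n : ℕ}
    (htoda : 4 * T (n + 2) * T n = T (n + 1) * derivative (derivative (T (n + 1))) -
      derivative (T (n + 1)) ^ 2 + 2 * ((n : ℝ[X]) + 1) * T (n + 1) ^ 2) {x : ℝ}
    (hx : (T (n + 1)).eval x ≠ 0) :
    logDerivFun₂ (T (n + 1)) x + 2 * ((n : ℝ) + 1) =
      4 * (T (n + 2)).eval x * (T n).eval x / (T (n + 1)).eval x ^ 2 := by
  have h := congrArg (eval x) htoda
  simp only [eval_mul, eval_sub, eval_add, eval_pow, eval_ofNat, eval_natCast, eval_one] at h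
  rw [logDerivFun₂, h]
  field_simp

theorem logDerivFun₃_eq {T : ℕ → ℝ[X]} {n : ℕ}
    (htoda : 4 * T (n + 2) * T n = T (n + 1) * derivative (derivative (T (n + 1))) -
      derivative (T (n + 1)) ^ 2 + 2 * ((n : ℝ[X]) + 1) * T (n + 1) ^ 2) {x : ℝ}
    (hx₀ : (T n).eval x ≠ 0) (hx₁ : (T (n + 1)).eval x ≠ 0) (hx₂ : (T (n + 2)).eval x ≠ 0) :
    logDerivFun₃ (T (n + 1)) x = (logDerivFun₂ (T (n + 1)) x + 2 * ((n : ℝ) + 1)) *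
      (logDerivFun (T (n + 2)) x + logDerivFun (T n) x - 2 * logDerivFun (T (n + 1)) x) := by
  have h := congrArg (eval x) htoda
  have h' := congrArg (fun P => eval x (derivative P)) htoda
  simp only [sq, derivative_mul, derivative_sub, derivative_add, derivative_ofNat,
    derivative_natCast, derivative_one, eval_mul, eval_sub, eval_add, eval_ofNat, eval_natCast,
    eval_one, eval_zero] at h h'
  rw [logDerivFun₂_add_eq htoda hx₁, logDerivFun₃, logDerivFun, logDerivFun, logDerivFun]
  field_simp
  linear_combination 2 * (derivative (T (n + 1))).eval x * h - (T (n + 1)).eval x * h'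

theorem todaRiccati_of_toda {a : ℕ} {T : ℕ → ℝ[X]} (hT : ∀ n, T n ≠ 0) (h0 : T 0 = 1)
    (h1 : derivative (derivative (T 1)) = 2 * (a : ℝ[X]) * T 1 - 2 * X * derivative (T 1))
    (htoda : ∀ n, 4 * T (n + 2) * T n = T (n + 1) * derivative (derivative (T (n + 1))) -
      derivative (T (n + 1)) ^ 2 + 2 * ((n : ℝ[X]) + 1) * T (n + 1) ^ 2) :
    TodaRiccati a (fun n => logDerivFun (T n)) (fun n => logDerivFun₂ (T n)) (todaTerm T) where
  hasDerivAt_V n := by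
    filter_upwards [eventually_eval_ne_zero (hT n)] with x hx using hasDerivAt_logDerivFun hx
  hasDerivAt_p n := by
    cases n with
    | zero =>
      refine .of_forall fun x => ?_
      have : logDerivFun₂ (T 0) = fun _ => 0 := by
        ext y
        simp [logDerivFun₂, h0]
      simpa [this, todaTerm] using hasDerivAt_const x (0 : ℝ)
    | succ n =>
      filter_upwards [eventually_eval_ne_zero (hT n), eventually_eval_ne_zero (hT (n + 1)),
        eventually_eval_ne_zero (hT (n + 2))] with x hx₀ hx₁ hx₂
      refine (hasDerivAt_logDerivFun₂ hx₁).congr_deriv ?_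
      rw [logDerivFun₃_eq (htoda n) hx₀ hx₁ hx₂, todaTerm]
      push_cast
      ring
  A_succ _ _ := rfl
  ne_zero n := by
    filter_upwards [eventually_eval_ne_zero (hT n), eventually_eval_ne_zero (hT (n + 1)),
      eventually_eval_ne_zero (hT (n + 2))] with x hx₀ hx₁ hx₂
    rw [logDerivFun₂_add_eq (htoda n) hx₁]
    positivity
  V_zero x := by simp [logDerivFun, h0]
  p_zero x := by simp [logDerivFun₂, h0]
  A_zero _ := rfl
  riccati := by
    filter_upwards [eventually_eval_ne_zero (hT 1)] with x hx
    have h := congrArg (eval x) h1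
    simp only [eval_mul, eval_sub, eval_ofNat, eval_natCast, eval_X] at h
    rw [logDerivFun₂, logDerivFun, h]
    field_simp
    ring

/-- The σ-form of Painlevé IV, cleared of denominators, for a polynomial tau function. -/
noncomputable def sigmaPoly (a n : ℕ) (T : ℝ[X]) : ℝ[X] :=
  (T ^ 2 * derivative (derivative (derivative T)) -
      3 * T * derivative T * derivative (derivative T) + 2 * derivative T ^ 3) ^ 2 -
    4 * T ^ 2 * (X * (T * derivative (derivative T) - derivative T ^ 2) - T * derivative T) ^ 2 +
    4 * (T * derivative (derivative T) - derivative T ^ 2) *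
      (T * derivative (derivative T) - derivative T ^ 2 - 2 * (a : ℝ[X]) * T ^ 2) *
      (T * derivative (derivative T) - derivative T ^ 2 + 2 * (n : ℝ[X]) * T ^ 2)

theorem eval_sigmaPoly (a n : ℕ) {T : ℝ[X]} {x : ℝ} (hx : T.eval x ≠ 0) :
    (sigmaPoly a n T).eval x = T.eval x ^ 6 * (logDerivFun₃ T x ^ 2 -
      4 * (x * logDerivFun₂ T x - logDerivFun T x) ^ 2 +
      4 * logDerivFun₂ T x * (logDerivFun₂ T x - 2 * a) * (logDerivFun₂ T x + 2 * n)) := by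
  simp only [sigmaPoly, eval_mul, eval_sub, eval_add, eval_pow, eval_ofNat, eval_natCast, eval_X]
  rw [logDerivFun₃, logDerivFun₂, logDerivFun]
  field_simp

theorem logDerivFun_sigma {a : ℕ} {T : ℕ → ℝ[X]} (hT : ∀ n, T n ≠ 0) (h0 : T 0 = 1)
    (h1 : derivative (derivative (T 1)) = 2 * (a : ℝ[X]) * T 1 - 2 * X * derivative (T 1))
    (htoda : ∀ n, 4 * T (n + 2) * T n = T (n + 1) * derivative (derivative (T (n + 1))) -
      derivative (T (n + 1)) ^ 2 + 2 * ((n : ℝ[X]) + 1) * T (n + 1) ^ 2)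
    (n : ℕ) {x : ℝ} (hx : (T n).eval x ≠ 0) :
    logDerivFun₃ (T n) x ^ 2 - 4 * (x * logDerivFun₂ (T n) x - logDerivFun (T n) x) ^ 2 +
      4 * logDerivFun₂ (T n) x * (logDerivFun₂ (T n) x - 2 * a) *
        (logDerivFun₂ (T n) x + 2 * n) = 0 := by
  have hTR := todaRiccati_of_toda hT h0 h1 htoda
  have hzero : sigmaPoly a n (T n) = 0 := by
    by_contra hne
    obtain ⟨y, hy, hTy, hp, hσ⟩ := ((eventually_eval_ne_zero hne).and
      ((eventually_eval_ne_zero (hT n)).and ((hTR.hasDerivAt_p n).and (hTR.sigma n)))).exists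
    rw [hp.unique (hasDerivAt_logDerivFun₂ hTy)] at hσ
    exact hy (by rw [eval_sigmaPoly a n hTy, hσ, mul_zero])
  have h := eval_sigmaPoly a n hx
  rw [hzero, eval_zero] at h
  exact (mul_eq_zero.mp h.symm).resolve_left (pow_ne_zero 6 hx)

end SigmaForm

end GUEMoments

open GUEMoments in
/-- On any open interval where `F_N(·;a)` is nonvanishing, its logarithmic derivative
`V_N = F_N'/F_N` satisfies the Jimbo–Miwa–Okamoto σ-form of PIV:
`(V'')² - 4(λV' - V)² + 4V'(V' - 2a)(V' + 2N) = 0`. -/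
theorem F_log_deriv_sigma_PIV (N : ℕ) (hN : 0 < N) (a : ℕ)
    (F : ℝ → ℝ)
    (hF : ∀ lam : ℝ, F lam = ∫ x : Fin N → ℝ,
        (∏ j, Real.exp (-(x j) ^ 2) * (lam - x j) ^ a)
          * ∏ j, ∏ k ∈ Finset.Ioi j, (x k - x j) ^ 2)
    (J : Set ℝ) (hJopen : IsOpen J) (hJinterval : J.OrdConnected)
    (hJne : ∀ lam ∈ J, F lam ≠ 0)
    (V : ℝ → ℝ) (hV : ∀ lam, V lam = deriv F lam / F lam) :
    ∀ lam ∈ J, (deriv (deriv V) lam) ^ 2 - 4 * (lam * deriv V lam - V lam) ^ 2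
        + 4 * deriv V lam * (deriv V lam - 2 * a) * (deriv V lam + 2 * N) = 0 := by
  intro lam hlam
  set q : ℕ → ℝ[X] := fun k => momentPoly (a + k)
  have hq (k : ℕ) : derivative (q k) = 2 * q (k + 1) - 2 * X * q k := derivative_momentPoly (a + k)
  have hFT : F = fun x => (N.factorial : ℝ) * (hankelDet q N).eval x := by
    ext x
    rw [hF, integral_eq_factorial_mul_hankelDet]
  have hVT : V = logDerivFun (hankelDet q N) := by
    ext x
    rw [hV, hFT, (((hankelDet q N).hasDerivAt x).const_mul (N.factorial : ℝ)).deriv,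
      mul_div_mul_left _ _ (by positivity), logDerivFun]
  have hne (x : ℝ) (hx : x ∈ J) : (hankelDet q N).eval x ≠ 0 := by
    have h := hJne x hx
    rw [hFT] at h
    exact right_ne_zero_of_mul h
  have hV₁ (x : ℝ) (hx : x ∈ J) : deriv V x = logDerivFun₂ (hankelDet q N) x := by
    rw [hVT, (hasDerivAt_logDerivFun (hne x hx)).deriv]
  have hV₂ : deriv (deriv V) lam = logDerivFun₃ (hankelDet q N) lam := by
    have heq : deriv V =ᶠ[nhds lam] logDerivFun₂ (hankelDet q N) :=
      Filter.eventuallyEq_of_mem (hJopen.mem_nhds hlam) hV₁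
    rw [heq.deriv_eq, (hasDerivAt_logDerivFun₂ (hne lam hlam)).deriv]
  rw [hV₂, hV₁ lam hlam, hVT]
  refine logDerivFun_sigma (hankelDet_ne_zero hq (momentPoly_ne_zero a)) ?_ ?_ (hankelDet_toda hq) N
    (hne lam hlam)
  · simp [hankelDet, hankelMinor]
  · simpa [hankelDet, hankelMinor, q] using derivative_derivative_momentPoly a
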